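/- For every L ≥ 1, every site i ∈ {0,…,L−1}, and every single-site operator O (a d×d complex matrix), one has Tr(ρ_T · O_i) = Tr(O)/d; equivalently, the single-site reduced density matrix of ρ_T at any site is exactly the maximally mixed state (1/d)·I_d. -/

import Mathlib

open scoped BigOperators

noncomputable section

/-- Cyclic shift by one site: `(shift σ) i = σ (i - 1)`. -/
def shift (d L : ℕ) (σ : ZMod L → Fin d) : ZMod L → Fin d := fun i => σ (i - 1)

/-- The translation operator `T` on `H = (ℂ^d)^{⊗L}`. -/
def Tmat (d L : ℕ) [NeZero L] : Matrix (ZMod L → Fin d) (ZMod L → Fin d) ℂ :=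
  Matrix.of fun τ σ => if τ = shift d L σ then 1 else 0

/-- The projector `P_T = (1/L)·∑_{k=0}^{L−1} T^k`. -/
def Pmat (d L : ℕ) [NeZero L] : Matrix (ZMod L → Fin d) (ZMod L → Fin d) ℂ :=
  (L : ℂ)⁻¹ • ∑ k ∈ Finset.range L, Tmat d L ^ k

/-- The maximally mixed invariant state of translation, `ρ_T = P_T / Tr(P_T)`. -/
def rhoT (d L : ℕ) [NeZero L] : Matrix (ZMod L → Fin d) (ZMod L → Fin d) ℂ :=
  ((Pmat d L).trace)⁻¹ • Pmat d L

/-- The operator `O_i`: a single-site operator `O` acting on site `i`, tensored with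
the identity on all other sites. -/
def siteOp (d L : ℕ) [NeZero L] (O : Matrix (Fin d) (Fin d) ℂ) (i : ZMod L) :
    Matrix (ZMod L → Fin d) (ZMod L → Fin d) ℂ :=
  Matrix.of fun τ σ => O (τ i) (σ i) * if (∀ j, j ≠ i → τ j = σ j) then 1 else 0

theorem Tmat_pow_apply (d L : ℕ) [NeZero L] (k : ℕ) (τ σ : ZMod L → Fin d) :
    (Tmat d L ^ k) τ σ = if τ = fun j => σ (j - k) then 1 else 0 := by
  induction k generalizing σ with
  | zero => simp [Matrix.one_apply]
  | succ k ih =>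
    rw [pow_succ, Matrix.mul_apply]
    simp only [Tmat, Matrix.of_apply, mul_ite, mul_one, mul_zero, Finset.sum_ite_eq',
      Finset.mem_univ, if_true]
    have h := ih (shift d L σ)
    simp only [Tmat] at h
    rw [h]
    have e : (fun j : ZMod L => shift d L σ (j - k)) = fun j => σ (j - (k + 1 : ℕ)) := by
      funext j
      simp only [shift]
      congr 1
      push_cast
      ring
    rw [e]

/-- A configuration agreeing with its translate away from one site is translation invariant. -/
theorem eq_translate_of_forall_ne {d L : ℕ} [NeZero L] (σ : ZMod L → Fin d) (i k : ZMod L)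
    (h : ∀ j, j ≠ i → σ j = σ (j - k)) : σ = fun j => σ (j - k) := by
  have hsum : ∑ j, (σ (j - k) : ℕ) = ∑ j, (σ j : ℕ) :=
    Equiv.sum_comp (Equiv.subRight k) fun j => (σ j : ℕ)
  rw [← Finset.add_sum_erase _ _ (Finset.mem_univ i),
    ← Finset.add_sum_erase (a := i) _ (fun j => (σ j : ℕ)) (Finset.mem_univ i),
    Finset.sum_congr rfl fun j hj => by rw [← h j (Finset.ne_of_mem_erase hj)]] at hsum
  funext j
  by_cases hj : j = i
  · subst hj
    exact Fin.ext (Nat.add_right_cancel hsum).symm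
  · exact h j hj

theorem trace_Tmat_pow (d L : ℕ) [NeZero L] (k : ℕ) :
    (Tmat d L ^ k).trace =
      ∑ σ : ZMod L → Fin d, if σ = fun j => σ (j - k) then (1 : ℂ) else 0 := by
  simp only [Matrix.trace, Matrix.diag, Tmat_pow_apply]

theorem trace_Tmat_pow_mul_siteOp (d L : ℕ) [NeZero L] (O : Matrix (Fin d) (Fin d) ℂ)
    (i : ZMod L) (k : ℕ) :
    (Tmat d L ^ k * siteOp d L O i).trace =
      ∑ σ : ZMod L → Fin d, if σ = fun j => σ (j - k) then O (σ i) (σ i) else 0 := by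
  rw [Matrix.trace_mul_comm]
  simp only [Matrix.trace, Matrix.diag, Matrix.mul_apply, Tmat_pow_apply, mul_ite, mul_one,
    mul_zero, Finset.sum_ite_eq', Finset.mem_univ, if_true, siteOp,
    Matrix.of_apply]
  refine Finset.sum_congr rfl fun σ _ => ?_
  by_cases h : ∀ j, j ≠ i → σ j = σ (j - k)
  · have e := eq_translate_of_forall_ne σ i k h
    rw [if_pos h, if_pos e, ← congrFun e i]
  · rw [if_neg h, if_neg fun e => h fun j _ => congrFun e j]

/-- Averaging over cyclic relabelings of the local basis. -/
theorem card_mul_trace_Tmat_pow_mul_siteOp (d L : ℕ) [NeZero L] [NeZero d]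
    (O : Matrix (Fin d) (Fin d) ℂ) (i : ZMod L) (k : ℕ) :
    (d : ℂ) * (Tmat d L ^ k * siteOp d L O i).trace = O.trace * (Tmat d L ^ k).trace := by
  rw [trace_Tmat_pow_mul_siteOp, trace_Tmat_pow]
  set S := ∑ σ : ZMod L → Fin d, if σ = fun j => σ (j - k) then O (σ i) (σ i) else 0 with hS
  have relabel (c : Fin d) : S = ∑ σ : ZMod L → Fin d,
      if σ = fun j => σ (j - k) then O (σ i + c) (σ i + c) else 0 := by
    rw [hS, ← Equiv.sum_comp (Equiv.addRight fun _ : ZMod L => c)]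
    simp only [Equiv.coe_addRight, Pi.add_apply, funext_iff, add_left_inj]
  calc (d : ℂ) * S = ∑ _c : Fin d, S := by simp
    _ = ∑ c : Fin d, ∑ σ : ZMod L → Fin d,
        if σ = fun j => σ (j - k) then O (σ i + c) (σ i + c) else 0 :=
      Finset.sum_congr rfl fun c _ => relabel c
    _ = _ := by
      rw [Finset.sum_comm, Finset.mul_sum]
      refine Finset.sum_congr rfl fun σ _ => ?_
      split_ifs
      · rw [mul_one]
        exact Equiv.sum_comp (Equiv.addLeft (σ i)) fun a => O a a
      · simp

theorem trace_Pmat_ne_zero (d L : ℕ) [NeZero L] [NeZero d] : (Pmat d L).trace ≠ 0 := by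
  have h : (∑ k ∈ Finset.range L, Tmat d L ^ k).trace =
      ((∑ k ∈ Finset.range L, ∑ σ : ZMod L → Fin d,
        if σ = fun j => σ (j - k) then 1 else 0 : ℕ) : ℂ) := by
    simp only [Matrix.trace_sum, trace_Tmat_pow]
    push_cast
    rfl
  rw [Pmat, Matrix.trace_smul, smul_eq_mul, h]
  refine mul_ne_zero (inv_ne_zero (NeZero.ne _)) (Nat.cast_ne_zero.mpr ?_)
  intro h0
  have h1 := Finset.sum_eq_zero_iff.mp h0 0 (Finset.mem_range.mpr (NeZero.pos L))
  have h2 := Finset.sum_eq_zero_iff.mp h1 (fun _ => 0) (Finset.mem_univ _)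
  simp at h2

/-- for every `L ≥ 1`, site `i`, and single-site operator `O`,
`Tr(ρ_T · O_i) = Tr(O)/d`; i.e. the single-site reduced density matrix of `ρ_T` is
exactly the maximally mixed state `(1/d)·I_d`. -/
theorem stmt14 (d L : ℕ) [NeZero L] (hd : 2 ≤ d) (hL : 1 ≤ L)
    (O : Matrix (Fin d) (Fin d) ℂ) (i : ZMod L) :
    (rhoT d L * siteOp d L O i).trace = O.trace / d := by
  have hd0 : (d : ℂ) ≠ 0 := by exact_mod_cast (by omega : d ≠ 0)
  have hL0 : (L : ℂ) ≠ 0 := by exact_mod_cast (by omega : L ≠ 0)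
  have : NeZero d := ⟨by omega⟩
  have key : (d : ℂ) * (Pmat d L * siteOp d L O i).trace = O.trace * (Pmat d L).trace := by
    simp only [Pmat, Matrix.smul_mul, Matrix.trace_smul, Matrix.sum_mul, Matrix.trace_sum,
      smul_eq_mul, Finset.mul_sum]
    refine Finset.sum_congr rfl fun k _ => ?_
    linear_combination (L : ℂ)⁻¹ * card_mul_trace_Tmat_pow_mul_siteOp d L O i k
  have hP : (Pmat d L).trace ≠ 0 := trace_Pmat_ne_zero d L
  rw [rhoT, Matrix.smul_mul, Matrix.trace_smul, smul_eq_mul, eq_div_iff hd0,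
    inv_mul_eq_div, div_mul_eq_mul_div, div_eq_iff hP]
  linear_combination key
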